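/- arXiv:2412.17071 — 2 statements merged into one kernel-verified Lean document; each statement's English description precedes it below -/
import Mathlib

section
/- Local separating estimates at an unstable equilibrium (Lemma 3.6): Let Φ be a semiflow on X strongly focusing monotone with respect to the k-cone C, satisfying the standing assumptions. Let p ∈ E be an equilibrium, let E_p, F_p be the invariant subspaces at p from the k-exponential separation along {p}, and let t₀ > 0 be such that every spectral value λ of D_pΦ_{t₀} restricted to E_p satisfies |λ| > 1 (equivalently, the spectral radius of (D_pΦ_{t₀}|_{E_p})^{−1} is less than 1). Then there exist constants ρ, κ*, T > 0 and T̃ > 2T such that: whenever y ∈ M_p = {y : y − p ∈ C, y ≠ p} satisfies Φ_t(y) ∈ B_ρ(p) for all t ∈ [0, N T̃] with N ∈ ℕ, then for every integer 0 ≤ n ≤ N one has ‖Φ_{nT̃+τ}(y) − p‖ ≥ 3ⁿ κ* ‖Φ_T(y) − p‖ for all τ ∈ [T, T̃+T], and ‖Φ_{nT̃+τ}(y) − p‖ ≥ 3^{n+1} ‖Φ_T(y) − p‖ for all τ ∈ [T̃, T̃+T]; consequently, if N > 0, then ‖Φ_{nT̃+τ}(y) − p‖ ≥ 3ⁿ ‖Φ_T(y)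 − p‖ for all τ ∈ [0, T] and every integer 1 ≤ n ≤ N+1. -/
open Set Metric Filter

/-- A semiflow on `X`: continuous on `[0,∞) × X`, `Φ₀ = id`, `Φ_{s+t} = Φ_s ∘ Φ_t`. -/
structure Semiflow (X : Type*) [NormedAddCommGroup X] [NormedSpace ℝ X] where
  toFun : ℝ → X → X
  cont : ContinuousOn (fun p : ℝ × X => toFun p.1 p.2) (Set.Ici (0:ℝ) ×ˢ Set.univ)
  map_zero : ∀ x, toFun 0 x = x
  map_add : ∀ s t : ℝ, 0 ≤ s → 0 ≤ t → ∀ x, toFun (s + t) x = toFun s (toFun t x)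

section Defs

variable {X : Type*} [NormedAddCommGroup X] [NormedSpace ℝ X]

/-- A cone of rank `k`: a closed set, stable under all real scalings, containing a
`k`-dimensional subspace and no subspace of higher dimension. -/
def IsKCone (C : Set X) (k : ℕ) : Prop :=
  IsClosed C ∧ (∀ (t : ℝ) (v : X), v ∈ C → t • v ∈ C) ∧
  (∃ W : Submodule ℝ X, (W : Set X) ⊆ C ∧ Module.rank ℝ W = k) ∧
  (∀ W : Submodule ℝ X, (W : Set X) ⊆ C → Module.rank ℝ W ≤ k)

/-- `C` is `k`-solid: some `k`-dimensional subspace `W` has `W \ {0} ⊆ int C`. -/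
def IsKSolid (C : Set X) (k : ℕ) : Prop :=
  ∃ W : Submodule ℝ X, Module.rank ℝ W = k ∧ ((W : Set X) \ {0}) ⊆ interior C

/-- `C` is complemented: some closed subspace of codimension `k` meets `C` only at `0`. -/
def IsComplementedCone (C : Set X) (k : ℕ) : Prop :=
  ∃ H : Submodule ℝ X, IsClosed (H : Set X) ∧ Module.rank ℝ (X ⧸ H) = k ∧
    (H : Set X) ∩ C = {0}

/-- The positive semiorbit `O⁺(x)`. -/
def posOrbit (Φ : Semiflow X) (x : X) : Set X := {y | ∃ t, 0 ≤ t ∧ y = Φ.toFun t x}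

/-- The ω-limit set `ω(x) = ⋂_{s ≥ 0} cl {Φ_t(x) : t ≥ s}`. -/
def omegaSet (Φ : Semiflow X) (x : X) : Set X :=
  ⋂ s ∈ Set.Ici (0:ℝ), closure {y | ∃ t, s ≤ t ∧ y = Φ.toFun t x}

/-- The set of equilibria of `Φ`. -/
def equilibria (Φ : Semiflow X) : Set X := {p | ∀ t, 0 ≤ t → Φ.toFun t p = p}

/-- `S` is invariant: `Φ_t(S) = S` for all `t ≥ 0`. -/
def Invariant (Φ : Semiflow X) (S : Set X) : Prop := ∀ t, 0 ≤ t → Φ.toFun t '' S = S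

/-- A set is ordered w.r.t. `C` if any two of its points are ordered. -/
def OrderedSet (C S : Set X) : Prop := ∀ x ∈ S, ∀ y ∈ S, x - y ∈ C

/-- A set is unordered w.r.t. `C` if it is not a singleton and any two distinct points are
unordered. -/
def UnorderedSet (C S : Set X) : Prop :=
  (¬ ∃ a, S = {a}) ∧ ∀ x ∈ S, ∀ y ∈ S, x ≠ y → x - y ∉ C

/-- Two sets `A ∼ B`: every point of `A` is ordered with every point of `B`. -/
def SetsOrdered (C A B : Set X) : Prop := ∀ a ∈ A, ∀ b ∈ B, a - b ∈ C

/-- `Φ` is strongly monotone with respect to the cone `C`. -/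
def StronglyMonotone (Φ : Semiflow X) (C : Set X) : Prop :=
  (∀ t, 0 ≤ t → ∀ x y : X, x - y ∈ C → Φ.toFun t x - Φ.toFun t y ∈ C) ∧
  (∀ t, 0 < t → ∀ x y : X, x - y ∈ C → x ≠ y → Φ.toFun t x - Φ.toFun t y ∈ interior C)

/-- `O⁺(x)` is pseudo-ordered. -/
def PseudoOrdered (Φ : Semiflow X) (C : Set X) (x : X) : Prop :=
  ∃ t₁ t₂ : ℝ, 0 ≤ t₁ ∧ 0 ≤ t₂ ∧ Φ.toFun t₁ x ≠ Φ.toFun t₂ x ∧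
    Φ.toFun t₁ x - Φ.toFun t₂ x ∈ C

/-- A bounded operator `R` is strongly focusing w.r.t. `C` with separation index `κ`:
`0 ∉ R(C \ {0})` and every unit vector of `RC` is at distance at least `κ` from `X \ C`. -/
def StronglyFocusing (R : X →L[ℝ] X) (C : Set X) (κ : ℝ) : Prop :=
  (∀ v ∈ C, v ≠ 0 → R v ≠ 0) ∧
  (∀ v ∈ R '' C, ‖v‖ = 1 → ∀ u ∉ C, κ ≤ ‖v - u‖)

/-- `Φ` is strongly focusing monotone with respect to `C`, with `x`-derivative `DΦ`. -/
def StronglyFocusingMonotone (Φ : Semiflow X) (DΦ : ℝ → X → X →L[ℝ] X) (C : Set X) : Prop :=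
  (∀ t, 0 ≤ t → ∀ x : X, HasFDerivAt (Φ.toFun t) (DΦ t x) x) ∧
  (∀ t, 0 ≤ t → Continuous fun x : X => DΦ t x) ∧
  StronglyMonotone Φ C ∧
  (∀ t, 0 < t → ∀ x : X, ∀ v ∈ C, v ≠ 0 → DΦ t x v ∈ interior C) ∧
  (∀ S : Set X, IsCompact S → Invariant Φ S →
    ∃ δ > (0:ℝ), ∃ T > (0:ℝ), ∃ κ > (0:ℝ), ∀ z ∈ S, ∀ x ∈ Metric.closedBall z δ,
      ∀ y ∈ Metric.closedBall z δ, ∃ R : X →L[ℝ] X,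
        StronglyFocusing R C κ ∧ R (x - y) = Φ.toFun T x - Φ.toFun T y)

/-- `ψ` is a flow extension of `Φ` on the invariant set `S`. -/
def IsFlowExtensionOn (Φ : Semiflow X) (ψ : ℝ → X → X) (S : Set X) : Prop :=
  (∀ t, 0 ≤ t → ∀ z ∈ S, ψ t z = Φ.toFun t z) ∧
  (∀ t : ℝ, ∀ z ∈ S, ψ t z ∈ S) ∧
  (∀ s t : ℝ, ∀ z ∈ S, ψ s (ψ t z) = ψ (s + t) z) ∧
  ContinuousOn (fun p : ℝ × X => ψ p.1 p.2) (Set.univ ×ˢ S)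

/-- `Φ` admits a flow extension on each ω-limit set. -/
def AdmitsFlowExtensions (Φ : Semiflow X) : Prop :=
  ∀ x : X, ∃ ψ : ℝ → X → X, IsFlowExtensionOn Φ ψ (omegaSet Φ x)

/-- The α-limit set of `z` along the (extended) flow `ψ`. -/
def alphaSet (ψ : ℝ → X → X) (z : X) : Set X :=
  ⋂ s ∈ Set.Ici (0:ℝ), closure {y | ∃ t, s ≤ t ∧ y = ψ (-t) z}

/-- Standing assumptions: `C` is a complemented `k`-solid `k`-cone, the derivative
`D_xΦ_t` is a compact operator for all `x` and `t > 0`, and `Φ` admits a flow extension on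
each ω-limit set. -/
def StandingAssumptions (Φ : Semiflow X) (DΦ : ℝ → X → X →L[ℝ] X)
    (C : Set X) (k : ℕ) : Prop :=
  IsKCone C k ∧ IsKSolid C k ∧ IsComplementedCone C k ∧
  (∀ t, 0 < t → ∀ x : X, IsCompactOperator ⇑(DΦ t x)) ∧
  AdmitsFlowExtensions Φ

end Defs

section ExpSep

variable {X : Type*} [NormedAddCommGroup X] [NormedSpace ℝ X]

/-- A `k`-exponential separation of `(Φ_t, DΦ_t)` along the compact invariant set `S`,
associated with the cone `C`: continuous bundles `E_p` (`k`-dimensional) and `F_p`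
(closed, `k`-codimensional) with `X = E_p ⊕ F_p`, invariance, the cone conditions
`E_p \ {0} ⊆ int C`, `F_p ∩ C = {0}`, and the dominated-splitting estimate. The
continuity of the bundles is expressed through a continuous family of projections. -/
def KExpSeparation (Φ : Semiflow X) (DΦ : ℝ → X → X →L[ℝ] X) (C : Set X) (k : ℕ)
    (S : Set X) (Ep Fp : X → Submodule ℝ X) : Prop :=
  (∀ p ∈ S, Module.rank ℝ (Ep p) = k ∧ IsClosed ((Fp p : Set X)) ∧
    Module.rank ℝ (X ⧸ Fp p) = k ∧ IsCompl (Ep p) (Fp p)) ∧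
  (∀ p ∈ S, ∀ t, 0 ≤ t →
    Submodule.map (DΦ t p : X →ₗ[ℝ] X) (Ep p) = Ep (Φ.toFun t p) ∧
    Submodule.map (DΦ t p : X →ₗ[ℝ] X) (Fp p) ≤ Fp (Φ.toFun t p)) ∧
  (∀ p ∈ S, ((Ep p : Set X) \ {0}) ⊆ interior C ∧ (Fp p : Set X) ∩ C = {0}) ∧
  (∃ P : X → X →L[ℝ] X, ContinuousOn P S ∧ ∀ p ∈ S,
    (∀ v : X, P p v ∈ Ep p) ∧ (∀ v ∈ Ep p, P p v = v) ∧ (∀ v ∈ Fp p, P p v = 0)) ∧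
  (∃ M > (0:ℝ), ∃ γ : ℝ, 0 < γ ∧ γ < 1 ∧ ∀ p ∈ S, ∀ t, 0 ≤ t →
    ∀ w ∈ Fp p, ‖w‖ = 1 → ∀ v ∈ Ep p, ‖v‖ = 1 →
      ‖DΦ t p w‖ ≤ M * γ ^ t * ‖DΦ t p v‖)

end ExpSep

open Topology

section SeparatingEstimates

variable {X : Type*} [NormedAddCommGroup X] [NormedSpace ℝ X]

/-- Joint continuity of a semiflow after extending it constantly to negative times. -/
lemma Semiflow.continuous_max (Φ : Semiflow X) :
    Continuous fun q : ℝ × X => Φ.toFun (max q.1 0) q.2 := by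
  have h : Continuous fun q : ℝ × X => (max q.1 0, q.2) := by fun_prop
  exact Φ.cont.comp_continuous h fun q => ⟨mem_Ici.2 (le_max_right _ _), mem_univ _⟩

/-- Orbits starting near an equilibrium stay near it on bounded time intervals. -/
lemma Semiflow.eventually_forall_mem_of_mem_nhds (Φ : Semiflow X) {p : X}
    (hp : p ∈ equilibria Φ) {U : Set X} (hU : U ∈ 𝓝 p) (b : ℝ) :
    ∀ᶠ x in 𝓝 p, ∀ t ∈ Icc 0 b, Φ.toFun t x ∈ U := by
  have h := (isCompact_Icc (a := (0 : ℝ)) (b := b)).eventually_forall_of_forall_eventually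
    (x₀ := p) (P := fun x t => Φ.toFun (max t 0) x ∈ U) (fun t ht => by
      have hc := (Φ.continuous_max.comp continuous_swap).continuousAt (x := (p, t))
      refine hc.eventually_mem ?_
      simpa [hp t ht.1, max_eq_left ht.1] using hU)
  filter_upwards [h] with x hx t ht
  simpa [max_eq_left ht.1] using hx t ht

/-- Baire category: near an equilibrium the time-`t` maps satisfy a common Lipschitz bound for
all `t` in some nondegenerate interval. -/
lemma Semiflow.exists_interval_lipschitz_at (Φ : Semiflow X) {p : X}
    (hp : p ∈ equilibria Φ) (hd : ∀ t, 0 ≤ t → DifferentiableAt ℝ (Φ.toFun t) p) :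
    ∃ a b : ℝ, 0 < a ∧ a < b ∧ ∃ L : ℝ, ∀ᶠ z in 𝓝 p, ∀ r ∈ Icc a b,
      ‖Φ.toFun r z - p‖ ≤ L * ‖z - p‖ := by
  let K : ℕ → Set ℝ := fun n => {s | ∀ z ∈ ball p (1 / ((n : ℝ) + 1)),
    ‖Φ.toFun (Real.exp s) z - p‖ ≤ n * ‖z - p‖}
  have hclosed : ∀ n, IsClosed (K n) := by
    intro n
    simp only [K, ofPred_forall]
    refine isClosed_iInter fun z => isClosed_iInter fun _ => ?_
    have hc : Continuous fun s : ℝ => Φ.toFun (Real.exp s) z := by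
      have h : Continuous fun s : ℝ => (Real.exp s, z) := by fun_prop
      exact Φ.cont.comp_continuous h fun s => ⟨mem_Ici.2 (Real.exp_pos s).le, mem_univ _⟩
    exact isClosed_le (by fun_prop) continuous_const
  have hunion : ⋃ n, K n = univ := by
    refine eq_univ_of_forall fun s => mem_iUnion.2 ?_
    have hs := (Real.exp_pos s).le
    obtain ⟨c, hc⟩ := (hd _ hs).hasFDerivAt.isBigO_sub.bound
    rw [hp _ hs] at hc
    obtain ⟨ε, hε, hball⟩ := Metric.eventually_nhds_iff_ball.1 hc
    obtain ⟨n₁, hn₁⟩ := exists_nat_ge c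
    obtain ⟨n₂, hn₂⟩ := exists_nat_one_div_lt hε
    refine ⟨max n₁ n₂, fun z hz => ?_⟩
    have hz' : z ∈ ball p ε := by
      refine ball_subset_ball (le_trans ?_ hn₂.le) hz
      gcongr
      exact le_max_right _ _
    refine (hball z hz').trans ?_
    gcongr
    exact hn₁.trans (by exact_mod_cast le_max_left _ _)
  obtain ⟨n, s, hs⟩ := nonempty_interior_of_iUnion_of_closed hclosed hunion
  obtain ⟨ε, hε, hball⟩ := Metric.nhds_basis_closedBall.mem_iff.1 (mem_interior_iff_mem_nhds.1 hs)
  refine ⟨Real.exp s, Real.exp (s + ε), Real.exp_pos s, Real.exp_lt_exp.2 (by linarith), n, ?_⟩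
  filter_upwards [ball_mem_nhds p (Nat.one_div_pos_of_nat (α := ℝ) (n := n))] with z hz r hr
  have hr0 : 0 < r := (Real.exp_pos s).trans_le hr.1
  have h1 : s ≤ Real.log r := (Real.le_log_iff_exp_le hr0).2 hr.1
  have h2 : Real.log r ≤ s + ε := (Real.log_le_iff_le_exp hr0).2 hr.2
  have hmem : Real.log r ∈ K n := hball (by
    rw [Metric.mem_closedBall, Real.dist_eq, abs_le]
    constructor <;> linarith)
  simpa [Real.exp_log hr0] using hmem z hz

/-- Near an equilibrium the time-`t` maps satisfy a common Lipschitz bound on intervals of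
arbitrary length. -/
lemma Semiflow.exists_long_interval_lipschitz_at (Φ : Semiflow X) {p : X}
    (hp : p ∈ equilibria Φ) (hd : ∀ t, 0 ≤ t → DifferentiableAt ℝ (Φ.toFun t) p) (l : ℝ) :
    ∃ a : ℝ, 0 < a ∧ ∃ L : ℝ, 0 < L ∧ ∀ᶠ z in 𝓝 p, ∀ r ∈ Icc a (a + l),
      ‖Φ.toFun r z - p‖ ≤ L * ‖z - p‖ := by
  obtain ⟨a, b, ha, hab, L₀, hL₀⟩ := Φ.exists_interval_lipschitz_at hp hd
  have key : ∀ j : ℕ, ∃ L : ℝ, 0 < L ∧ ∀ᶠ z in 𝓝 p, ∀ r ∈ Icc a (b + j * (b - a)),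
      ‖Φ.toFun r z - p‖ ≤ L * ‖z - p‖ := by
    intro j
    induction j with
    | zero =>
      refine ⟨max L₀ 1, by positivity, ?_⟩
      filter_upwards [hL₀] with z hz r hr
      refine (hz r (by simpa using hr)).trans ?_
      gcongr
      exact le_max_left _ _
    | succ j ih =>
      obtain ⟨L, hL, hLz⟩ := ih
      have hba : 0 ≤ b - a := by linarith
      obtain ⟨c, hc, hcz⟩ := (hd _ hba).hasFDerivAt.isBigO_sub.exists_pos
      have hcz := hcz.bound
      rw [hp _ hba] at hcz
      have hcont : ContinuousAt (Φ.toFun (b - a)) p := (hd _ hba).continuousAt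
      rw [ContinuousAt, hp _ hba] at hcont
      refine ⟨max L (L * c), lt_max_of_lt_left hL, ?_⟩
      filter_upwards [hLz, hcz, hcont.eventually hLz] with z h1 h2 h3 r hr
      have hr2 := hr.2
      push_cast at hr2
      rcases le_total r (b + j * (b - a)) with h | h
      · refine (h1 r ⟨hr.1, h⟩).trans ?_
        gcongr
        exact le_max_left _ _
      · have hj : 0 ≤ (j : ℝ) * (b - a) := by positivity
        have heq : Φ.toFun r z = Φ.toFun (r - (b - a)) (Φ.toFun (b - a) z) := by
          rw [← Φ.map_add _ _ (by linarith) hba]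
          congr 1
          ring
        rw [heq]
        calc _ ≤ L * ‖Φ.toFun (b - a) z - p‖ := h3 _ ⟨by linarith, by linarith⟩
          _ ≤ L * (c * ‖z - p‖) := by gcongr
          _ = L * c * ‖z - p‖ := by ring
          _ ≤ max L (L * c) * ‖z - p‖ := by
            gcongr
            exact le_max_right _ _
  obtain ⟨j, hj⟩ := exists_nat_ge (l / (b - a))
  rw [div_le_iff₀ (by linarith)] at hj
  obtain ⟨L, hL, hLz⟩ := key j
  refine ⟨a, ha, L, hL, ?_⟩
  filter_upwards [hLz] with z hz r hr
  exact hz r ⟨hr.1, by linarith [hr.2]⟩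

lemma Semiflow.iterate_toFun (Φ : Semiflow X) {t : ℝ} (ht : 0 ≤ t) (m : ℕ) (x : X) :
    (Φ.toFun t)^[m] x = Φ.toFun (m * t) x := by
  induction m with
  | zero => simp [Φ.map_zero]
  | succ m ih =>
    rw [Function.iterate_succ_apply', ih, ← Φ.map_add _ _ ht (by positivity)]
    congr 1
    push_cast
    ring

/-- A strongly focusing operator maps the cone away from any subspace that meets it trivially:
the complementary projection is bounded below on the image. -/
lemma StronglyFocusing.le_norm_projection {R : X →L[ℝ] X} {C : Set X} {κ : ℝ}
    (hR : StronglyFocusing R C κ) (hC : ∀ (t : ℝ) (v : X), v ∈ C → t • v ∈ C)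
    {F : Submodule ℝ X} (hF : (F : Set X) ∩ C = {0}) {P : X →L[ℝ] X}
    (hP : ∀ v, v - P v ∈ F) {v : X} (hv : v ∈ C) :
    min κ 1 * ‖R v‖ ≤ ‖P (R v)‖ := by
  rcases eq_or_ne (R v) 0 with h0 | h0
  · simp [h0]
  have hpos : 0 < ‖R v‖ := norm_pos_iff.2 h0
  set w : X := ‖R v‖⁻¹ • R v with hw
  have hw1 : ‖w‖ = 1 := by rw [hw, norm_smul, norm_inv, norm_norm, inv_mul_cancel₀ hpos.ne']
  have hwR : w ∈ R '' C := ⟨‖R v‖⁻¹ • v, hC _ _ hv, by rw [map_smul]⟩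
  have hPw : min κ 1 ≤ ‖P w‖ := by
    by_cases hmem : w - P w ∈ C
    · have h : w - P w = 0 := by
        have : w - P w ∈ (F : Set X) ∩ C := ⟨hP w, hmem⟩
        rwa [hF] at this
      rw [← sub_eq_zero.1 h, hw1]
      exact min_le_right _ _
    · refine (min_le_left _ _).trans ((hR.2 w hwR hw1 _ hmem).trans_eq ?_)
      rw [sub_sub_cancel]
  rw [hw, map_smul, norm_smul, norm_inv, norm_norm, le_inv_mul_iff₀ hpos] at hPw
  linarith

/-- If `A` preserves the splitting given by the projection `P`, and its powers expand the range
of `P`, then they expand every vector whose projection is bounded below. -/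
lemma norm_pow_apply_lower_bound {A P : X →L[ℝ] X} (hAP : Commute P A)
    {C₀ c κ : ℝ} (hC₀ : 0 ≤ C₀) (hc : 0 ≤ c)
    (hexp : ∀ (n : ℕ) (v : X), C₀ * c ^ n * ‖P v‖ ≤ ‖(A ^ n) (P v)‖)
    {v : X} (hv : κ * ‖v‖ ≤ ‖P v‖) (m : ℕ) :
    C₀ * κ / (‖P‖ + 1) * c ^ m * ‖v‖ ≤ ‖(A ^ m) v‖ := by
  have h1 : P ((A ^ m) v) = (A ^ m) (P v) :=
    congrArg (fun B : X →L[ℝ] X => B v) (hAP.pow_right m).eq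
  have h2 : ‖P ((A ^ m) v)‖ ≤ (‖P‖ + 1) * ‖(A ^ m) v‖ :=
    (P.le_opNorm _).trans (by gcongr; linarith)
  have h3 : C₀ * c ^ m * (κ * ‖v‖) ≤ (‖P‖ + 1) * ‖(A ^ m) v‖ := by
    refine le_trans ?_ ((hexp m v).trans (h1 ▸ h2))
    gcongr
  calc _ = (C₀ * c ^ m * (κ * ‖v‖)) / (‖P‖ + 1) := by ring
    _ ≤ _ := by
      rw [div_le_iff₀ (by positivity)]
      linarith

/-- Growth over one step of length `Tt`, uniformly for points near the equilibrium which are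
ordered with it. -/
lemma exists_one_step_estimate
    (Φ : Semiflow X) {p : X} (hp : p ∈ equilibria Φ) {C : Set X}
    {A P : X →L[ℝ] X} {t₀ : ℝ} (ht₀ : 0 < t₀) (hA : HasFDerivAt (Φ.toFun t₀) A p)
    (hd : ∀ t, 0 ≤ t → DifferentiableAt ℝ (Φ.toFun t) p)
    (hAP : Commute P A) {C₀ c : ℝ} (hC₀ : 0 < C₀) (hc : 1 < c)
    (hexp : ∀ (n : ℕ) (v : X), C₀ * c ^ n * ‖P v‖ ≤ ‖(A ^ n) (P v)‖)
    {δ T κ : ℝ} (hδ : 0 < δ) (hT : 0 < T) (hκ : 0 < κ)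
    (hfoc : ∀ y ∈ closedBall p δ, y - p ∈ C → y ≠ p →
      Φ.toFun T y ≠ p ∧ κ * ‖Φ.toFun T y - p‖ ≤ ‖P (Φ.toFun T y - p)‖) :
    ∃ ρ : ℝ, 0 < ρ ∧ ∃ κs : ℝ, 0 < κs ∧ ∃ Tt : ℝ, 2 * T < Tt ∧
      ∀ y ∈ closedBall p ρ, y - p ∈ C → y ≠ p →
        Φ.toFun T y ≠ p ∧
        (∀ τ ∈ Icc T (Tt + T), κs * ‖Φ.toFun T y - p‖ ≤ ‖Φ.toFun τ y - p‖) ∧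
        (∀ τ ∈ Icc Tt (Tt + T), 3 * ‖Φ.toFun T y - p‖ ≤ ‖Φ.toFun τ y - p‖) := by
  obtain ⟨a, ha, L, hL, hLip⟩ := Φ.exists_long_interval_lipschitz_at hp hd t₀
  set c₁ : ℝ := C₀ * κ / (‖P‖ + 1) with hc₁
  have hc₁0 : 0 < c₁ := by positivity
  obtain ⟨M₀, hM₀⟩ := pow_unbounded_of_one_lt (3 * (2 * L) / c₁) hc
  obtain ⟨Tt, hTt⟩ : ∃ Tt, Tt = 2 * T + M₀ * t₀ + 1 := ⟨_, rfl⟩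
  have hM₀t : 0 ≤ (M₀ : ℝ) * t₀ := by positivity
  obtain ⟨Mmax, hMmax⟩ := exists_nat_ge ((Tt + a + t₀) / t₀)
  rw [div_le_iff₀ ht₀] at hMmax
  have hgrid : ∀ m : ℕ, ∀ᶠ x in 𝓝 p, κ * ‖x - p‖ ≤ ‖P (x - p)‖ →
      c₁ / 2 * c ^ m * ‖x - p‖ ≤ ‖Φ.toFun (m * t₀) x - p‖ := by
    intro m
    have hder : HasFDerivAt (Φ.toFun (m * t₀)) (A ^ m) p := by
      have h := HasFDerivAt.iterate hA (hp _ ht₀.le) m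
      rwa [funext (Φ.iterate_toFun ht₀.le m)] at h
    have hpm : Φ.toFun (m * t₀) p = p := hp _ (by positivity)
    have hε : 0 < c₁ / 2 * c ^ m := by positivity
    have ho := hder.isLittleO.bound hε
    filter_upwards [ho] with x hx hPx
    rw [hpm] at hx
    have h1 := norm_pow_apply_lower_bound hAP hC₀.le (by linarith) hexp hPx m
    have h2 : ‖(A ^ m) (x - p)‖ ≤ ‖Φ.toFun (m * t₀) x - p‖
        + ‖Φ.toFun (m * t₀) x - p - (A ^ m) (x - p)‖ := by
      rw [norm_sub_rev (Φ.toFun (m * t₀) x - p)]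
      exact norm_le_norm_add_norm_sub' _ _
    rw [← hc₁] at h1
    linarith
  have hgrid' : ∀ᶠ x in 𝓝 p, ∀ m ∈ Iic Mmax, κ * ‖x - p‖ ≤ ‖P (x - p)‖ →
      c₁ / 2 * c ^ m * ‖x - p‖ ≤ ‖Φ.toFun (m * t₀) x - p‖ :=
    (eventually_all_finite (finite_Iic Mmax)).2 fun m _ => hgrid m
  have hev := (Φ.eventually_forall_mem_of_mem_nhds hp (hgrid'.and hLip) (Tt + T)).and
    (closedBall_mem_nhds p hδ)
  obtain ⟨ρ, hρ, hball⟩ := Metric.nhds_basis_closedBall.mem_iff.1 hev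
  have main : ∀ y ∈ closedBall p ρ, y - p ∈ C → y ≠ p → ∀ τ ∈ Icc T (Tt + T),
      ∃ m : ℕ, τ - T ≤ m * t₀ ∧
        c₁ / (2 * L) * c ^ m * ‖Φ.toFun T y - p‖ ≤ ‖Φ.toFun τ y - p‖ := by
    intro y hy hyC hyp τ hτ
    obtain ⟨hyU, hyδ⟩ := hball hy
    have hPx := (hfoc y hyδ hyC hyp).2
    have h0 : 0 ≤ (τ - T + a) / t₀ := div_nonneg (by linarith [hτ.1]) ht₀.le
    have hm1 := Nat.le_ceil ((τ - T + a) / t₀)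
    have hm2 := Nat.ceil_lt_add_one h0
    set m := ⌈(τ - T + a) / t₀⌉₊
    rw [div_le_iff₀ ht₀] at hm1
    rw [div_add_one ht₀.ne', lt_div_iff₀ ht₀] at hm2
    have hmM : m ≤ Mmax := by
      have : (m : ℝ) * t₀ ≤ Mmax * t₀ := by linarith [hτ.2]
      exact_mod_cast le_of_mul_le_mul_right this ht₀
    refine ⟨m, by linarith, ?_⟩
    have hTmem : T ∈ Icc 0 (Tt + T) := ⟨hT.le, by linarith [hτ.1, hτ.2]⟩
    have hlow := (hyU T hTmem).1 m hmM hPx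
    have hup := (hyU τ ⟨hT.le.trans hτ.1, hτ.2⟩).2 (m * t₀ - (τ - T))
      ⟨by linarith, by linarith⟩
    have heq : Φ.toFun (m * t₀ - (τ - T)) (Φ.toFun τ y)
        = Φ.toFun (m * t₀) (Φ.toFun T y) := by
      rw [← Φ.map_add _ _ (by linarith) (by linarith [hτ.1]),
        ← Φ.map_add _ _ (by positivity) hT.le]
      congr 1
      ring
    rw [heq] at hup
    calc _ = (c₁ / 2 * c ^ m * ‖Φ.toFun T y - p‖) / L := by ring
      _ ≤ _ := by
        rw [div_le_iff₀ hL]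
        linarith
  refine ⟨ρ, hρ, c₁ / (2 * L), by positivity, Tt, by linarith, fun y hy hyC hyp =>
    ⟨(hfoc y (hball hy).2 hyC hyp).1, fun τ hτ => ?_, fun τ hτ => ?_⟩⟩
  · obtain ⟨m, -, hm⟩ := main y hy hyC hyp τ hτ
    refine le_trans ?_ hm
    gcongr
    exact le_mul_of_one_le_right (by positivity) (one_le_pow₀ hc.le)
  · obtain ⟨m, hmτ, hm⟩ := main y hy hyC hyp τ ⟨by linarith [hτ.1], hτ.2⟩
    refine le_trans ?_ hm
    have hMm : M₀ ≤ m := by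
      have : (M₀ : ℝ) * t₀ ≤ m * t₀ := by linarith [hτ.1]
      exact_mod_cast le_of_mul_le_mul_right this ht₀
    have hpow : c ^ M₀ ≤ c ^ m := pow_le_pow_right₀ hc.le hMm
    gcongr
    rw [div_lt_iff₀ hc₁0] at hM₀
    rw [div_mul_eq_mul_div, le_div_iff₀ (by positivity)]
    nlinarith

end SeparatingEstimates

/-- **Local separating estimates at an unstable equilibrium (Lemma 3.6).** Let `p` be an
equilibrium with invariant subspaces `Ep, Fp` from the `k`-exponential separation along
`{p}`, and let `t₀ > 0` be such that every spectral value of `D_pΦ_{t₀}|_{E_p}` has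
modulus `> 1` (stated as exponential growth from below of the iterates on `Ep`). Then
there are `ρ, κ*, T > 0` and `T̃ > 2T` such that for any `y ∼ p`, `y ≠ p` whose orbit
stays in `B_ρ(p)` on `[0, N T̃]`, the stated lower growth estimates hold. -/
theorem local_separating_estimates
    {X : Type*} [NormedAddCommGroup X] [NormedSpace ℝ X] [CompleteSpace X]
    (Φ : Semiflow X) (DΦ : ℝ → X → X →L[ℝ] X) (C : Set X) (k : ℕ) (hk : 1 ≤ k)
    (hSA : StandingAssumptions Φ DΦ C k)
    (hSFM : StronglyFocusingMonotone Φ DΦ C)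
    (p : X) (hp : p ∈ equilibria Φ)
    (Ep Fp : Submodule ℝ X)
    (hsep : KExpSeparation Φ DΦ C k {p} (fun _ => Ep) (fun _ => Fp))
    (t₀ : ℝ) (ht₀ : 0 < t₀)
    (hspec : ∃ c : ℝ, 1 < c ∧ ∃ C₀ : ℝ, 0 < C₀ ∧ ∀ n : ℕ, ∀ v ∈ Ep,
      C₀ * c ^ n * ‖v‖ ≤ ‖((DΦ t₀ p) ^ n) v‖) :
    ∃ ρ : ℝ, 0 < ρ ∧ ∃ κs : ℝ, 0 < κs ∧ ∃ T : ℝ, 0 < T ∧ ∃ Tt : ℝ, 2 * T < Tt ∧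
      ∀ y : X, y - p ∈ C → y ≠ p → ∀ N : ℕ,
        (∀ t ∈ Set.Icc (0:ℝ) ((N : ℝ) * Tt), Φ.toFun t y ∈ Metric.closedBall p ρ) →
        (∀ n : ℕ, n ≤ N →
          (∀ τ ∈ Set.Icc T (Tt + T),
            (3:ℝ) ^ n * κs * ‖Φ.toFun T y - p‖ ≤ ‖Φ.toFun ((n : ℝ) * Tt + τ) y - p‖) ∧
          (∀ τ ∈ Set.Icc Tt (Tt + T),
            (3:ℝ) ^ (n + 1) * ‖Φ.toFun T y - p‖ ≤ ‖Φ.toFun ((n : ℝ) * Tt + τ) y - p‖)) ∧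
        (0 < N → ∀ n : ℕ, 1 ≤ n → n ≤ N + 1 → ∀ τ ∈ Set.Icc (0:ℝ) T,
          (3:ℝ) ^ n * ‖Φ.toFun T y - p‖ ≤ ‖Φ.toFun ((n : ℝ) * Tt + τ) y - p‖) := by
  obtain ⟨⟨-, hCscal, -, -⟩, -⟩ := hSA
  obtain ⟨hder, -, hmono, -, hfocus⟩ := hSFM
  obtain ⟨hsplit, hinv, hcone, ⟨P, -, hP⟩, -⟩ := hsep
  obtain ⟨-, -, -, hcompl⟩ := hsplit p rfl
  obtain ⟨-, hFC⟩ := hcone p rfl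
  obtain ⟨hPE, hPid, hPF⟩ := hP p rfl
  obtain ⟨c, hc, C₀, hC₀, hgrow⟩ := hspec
  have hsubF : ∀ v, v - P p v ∈ Fp := by
    intro v
    obtain ⟨e, he, f, hf, rfl⟩ := Submodule.mem_sup.1 (hcompl.sup_eq_top ▸ Submodule.mem_top (x := v))
    simpa [hPid e he, hPF f hf] using hf
  have hcomm : Commute (P p) (DΦ t₀ p) := by
    obtain ⟨hE, hF⟩ : Submodule.map (DΦ t₀ p : X →ₗ[ℝ] X) Ep = Ep ∧
        Submodule.map (DΦ t₀ p : X →ₗ[ℝ] X) Fp ≤ Fp := hinv p rfl t₀ ht₀.le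
    ext v
    have h1 : DΦ t₀ p (P p v) ∈ Ep := hE.le (Submodule.mem_map_of_mem (hPE v))
    have h2 : DΦ t₀ p (v - P p v) ∈ Fp := hF (Submodule.mem_map_of_mem (hsubF v))
    have h3 := hPF _ h2
    rw [map_sub, map_sub, hPid _ h1, sub_eq_zero] at h3
    exact h3
  obtain ⟨δ, hδ, T, hT, κ, hκ, hR⟩ := hfocus {p} isCompact_singleton
    (fun t ht => by rw [image_singleton, hp t ht])
  have hfoc : ∀ y ∈ closedBall p δ, y - p ∈ C → y ≠ p →
      Φ.toFun T y ≠ p ∧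
        min κ 1 * ‖Φ.toFun T y - p‖ ≤ ‖P p (Φ.toFun T y - p)‖ := by
    intro y hy hyC hyp
    obtain ⟨R, hRf, hReq⟩ := hR p rfl y hy p (mem_closedBall_self hδ.le)
    rw [hp T hT.le] at hReq
    refine ⟨fun h => hRf.1 _ hyC (sub_ne_zero.2 hyp) (by rw [hReq, h, sub_self]), ?_⟩
    rw [← hReq]
    exact hRf.le_norm_projection hCscal hFC hsubF hyC
  obtain ⟨ρ, hρ, κs, hκs, Tt, hTt, hstep⟩ := exists_one_step_estimate Φ hp ht₀
    (hder t₀ ht₀.le p) (fun t ht => (hder t ht p).differentiableAt) hcomm hC₀ hc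
    (fun n v => hgrow n _ (hPE v)) hδ hT (lt_min hκ one_pos) hfoc
  refine ⟨ρ, hρ, κs, hκs, T, hT, Tt, hTt, fun y hyC hyp N hN => ?_⟩
  have hTt0 : 0 ≤ Tt := by linarith
  have hball : ∀ n : ℕ, n ≤ N → Φ.toFun (n * Tt) y ∈ closedBall p ρ := fun n hn =>
    hN _ ⟨by positivity, by gcongr⟩
  have hord : ∀ n : ℕ, Φ.toFun (n * Tt) y - p ∈ C := by
    intro n
    have hnT : 0 ≤ (n : ℝ) * Tt := by positivity
    simpa [hp _ hnT] using hmono.1 _ hnT y p hyC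
  have hadd : ∀ (n : ℕ) (τ : ℝ), 0 ≤ τ →
      Φ.toFun (n * Tt + τ) y = Φ.toFun τ (Φ.toFun (n * Tt) y) := by
    intro n τ hτ
    rw [add_comm, Φ.map_add _ _ hτ (by positivity)]
  have hind : ∀ n : ℕ, n ≤ N → Φ.toFun (n * Tt) y ≠ p ∧
      (3 : ℝ) ^ n * ‖Φ.toFun T y - p‖ ≤ ‖Φ.toFun T (Φ.toFun (n * Tt) y) - p‖ := by
    intro n
    induction n with
    | zero => simp [Φ.map_zero, hyp]
    | succ n ih =>
      intro hn
      obtain ⟨hne, hle⟩ := ih (by omega)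
      obtain ⟨hTne, -, h3⟩ := hstep _ (hball n (by omega)) (hord n) hne
      have h := h3 (Tt + T) ⟨by linarith, le_rfl⟩
      have heq : Φ.toFun (Tt + T) (Φ.toFun (n * Tt) y)
          = Φ.toFun T (Φ.toFun ((n + 1 : ℕ) * Tt) y) := by
        rw [← hadd n _ (by linarith), ← hadd (n + 1) _ hT.le]
        congr 1
        push_cast
        ring
      rw [heq] at h
      refine ⟨fun h0 => ?_, ?_⟩
      · rw [h0, hp T hT.le, sub_self, norm_zero] at h
        have := norm_pos_iff.2 (sub_ne_zero.2 hTne)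
        linarith
      · rw [pow_succ]
        linarith
  have hmain : ∀ n : ℕ, n ≤ N →
      (∀ τ ∈ Icc T (Tt + T),
        (3 : ℝ) ^ n * κs * ‖Φ.toFun T y - p‖ ≤ ‖Φ.toFun ((n : ℝ) * Tt + τ) y - p‖) ∧
      (∀ τ ∈ Icc Tt (Tt + T),
        (3 : ℝ) ^ (n + 1) * ‖Φ.toFun T y - p‖ ≤ ‖Φ.toFun ((n : ℝ) * Tt + τ) y - p‖) := by
    intro n hn
    obtain ⟨hne, hle⟩ := hind n hn
    obtain ⟨-, h1, h3⟩ := hstep _ (hball n hn) (hord n) hne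
    refine ⟨fun τ hτ => ?_, fun τ hτ => ?_⟩
    · rw [hadd n τ (hT.le.trans hτ.1)]
      have := mul_le_mul_of_nonneg_left hle hκs.le
      linarith [h1 τ hτ]
    · rw [hadd n τ (hTt0.trans hτ.1), pow_succ]
      linarith [h3 τ hτ]
  refine ⟨hmain, fun _ n hn1 hnN τ hτ => ?_⟩
  obtain ⟨n, rfl⟩ := Nat.exists_eq_add_of_le' hn1
  have h := (hmain n (by omega)).2 (Tt + τ) ⟨by linarith [hτ.1], by linarith [hτ.2]⟩
  have heq : ((n + 1 : ℕ) : ℝ) * Tt + τ = n * Tt + (Tt + τ) := by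
    push_cast
    ring
  rwa [heq]
end

section
/- Alternative (b) of the order trichotomy does not occur (Lemma 4.1): Let Φ be a semiflow on X strongly focusing monotone with respect to the k-cone C, satisfying the standing assumptions, and let O⁺(x) be a precompact pseudo-ordered semiorbit. Then it is not the case that ω(x) ⊆ E and ω(x) is unordered; i.e., ω(x) is not an unordered set consisting of equilibria. -/
open Set Metric Filter

open Topology

section ConeGrowth

variable {X : Type*} [NormedAddCommGroup X] [NormedSpace ℝ X]

/-- If `A` focuses a homogeneous cone `C` and fixes a vector `w` outside `C`, then the powers of
`A` expand every vector well inside `C` at an exponential rate. -/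
theorem exists_exp_growth_of_focusing {C : Set X} (hC : IsClosed C)
    (hsmul : ∀ (t : ℝ) (v : X), v ∈ C → t • v ∈ C) (A : X →L[ℝ] X) {κ : ℝ} (hκ : 0 < κ)
    (hfoc : ∀ v ∈ C, ∀ u ∉ C, κ * ‖A v‖ ≤ ‖A v - u‖) (hinv : ∀ v ∈ C, A v ∈ C)
    {w : X} (hw : w ∉ C) (hw1 : ‖w‖ = 1) (hAw : A w = w) :
    ∃ c > (0:ℝ), ∃ l > (1:ℝ), ∀ (n : ℕ) (v : X), v ∈ C → (∀ u ∉ C, κ * ‖v‖ ≤ ‖v - u‖) →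
      c * l ^ n * ‖v‖ ≤ ‖(A ^ n) v‖ := by
  obtain ⟨d, hd, hdC⟩ : ∃ d > (0:ℝ), ∀ v ∈ C, d < ‖v - w‖ := by
    obtain ⟨e, he, heC⟩ := Metric.isOpen_iff.1 hC.isOpen_compl w hw
    refine ⟨e / 2, by positivity, fun v hv => ?_⟩
    by_contra! h
    exact heC (show v ∈ ball w e by rw [mem_ball_iff_norm]; linarith) hv
  have hdC' : ∀ v ∈ C, ∀ s : ℝ, s ≠ 0 → d * |s| < ‖v + s • w‖ := by
    intro v hv s hs
    have h := hdC _ (hsmul (-s⁻¹) v hv)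
    have e : v + s • w = (-s) • ((-s⁻¹) • v - w) := by
      rw [smul_sub, smul_smul]
      have : -s * -s⁻¹ = 1 := by field_simp
      rw [this, one_smul, neg_smul, sub_neg_eq_add]
    rw [e, norm_smul, norm_neg, Real.norm_eq_abs, mul_comm]
    exact mul_lt_mul_of_pos_left h (abs_pos.2 hs)
  have hκd : 0 < κ * d := mul_pos hκ hd
  have step : ∀ (r : ℝ) (v : X), v ∈ C → (∀ s : ℝ, |s| < r → v + s • w ∈ C) →
      ∀ s : ℝ, |s| < (1 + κ * d) * r → A v + s • w ∈ C := by
    intro r v hv hr s hs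
    by_cases hs0 : s = 0
    · simpa [hs0] using hinv v hv
    obtain ⟨s', rfl⟩ : ∃ s', s = (1 + κ * d) * s' := ⟨s / (1 + κ * d), by field_simp⟩
    have hs' : s' ≠ 0 := right_ne_zero_of_mul hs0
    rw [abs_mul, abs_of_pos (by linarith : 0 < 1 + κ * d)] at hs
    have h1 := hr s' (lt_of_mul_lt_mul_left hs (by linarith))
    by_contra hu
    have h2 := hfoc _ h1 _ hu
    have h3 := hdC' _ (hinv v hv) s' hs'
    have e1 : A (v + s' • w) = A v + s' • w := by simp [hAw]
    have e2 : A v + s' • w - (A v + ((1 + κ * d) * s') • w) = (-(κ * d * s')) • w := by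
      module
    rw [e1, e2, norm_smul, hw1, norm_neg, Real.norm_eq_abs, abs_mul, abs_of_pos hκd] at h2
    nlinarith
  refine ⟨d * κ, by positivity, 1 + κ * d, by linarith, fun n v hv hvf => ?_⟩
  have key : ∀ n : ℕ, (A ^ n) v ∈ C ∧
      ∀ s : ℝ, |s| < (1 + κ * d) ^ n * (κ * ‖v‖) → (A ^ n) v + s • w ∈ C := by
    intro n
    induction n with
    | zero =>
      refine ⟨by simpa using hv, fun s hs => ?_⟩
      by_contra hu
      have := hvf _ hu
      simp [norm_smul, hw1] at this hs
      linarith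
    | succ n ih =>
      have e : (A ^ (n + 1)) v = A ((A ^ n) v) := by rw [pow_succ']; rfl
      rw [e]
      refine ⟨hinv _ ih.1, fun s hs => step _ _ ih.1 ih.2 s ?_⟩
      rw [pow_succ'] at hs
      linarith
  obtain ⟨h1, h2⟩ := key n
  by_contra! hlt
  have : ‖(A ^ n) v‖ / d < (1 + κ * d) ^ n * (κ * ‖v‖) := by
    rw [div_lt_iff₀ hd]; linarith
  obtain ⟨s, hs1, hs2⟩ := exists_between this
  have hs0 : 0 < s := lt_of_le_of_lt (by positivity) hs1
  have h3 := hdC _ (hsmul s⁻¹ _ (h2 s (by rwa [abs_of_pos hs0])))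
  have e : s⁻¹ • ((A ^ n) v + s • w) - w = s⁻¹ • (A ^ n) v := by
    rw [smul_add, inv_smul_smul₀ hs0.ne', add_sub_cancel_right]
  rw [e, norm_smul, Real.norm_eq_abs, abs_of_pos (inv_pos.2 hs0), inv_mul_eq_div,
    lt_div_iff₀ hs0] at h3
  rw [div_lt_iff₀ hd] at hs1
  linarith

theorem zero_notMem_interior_of_smul_mem {C : Set X}
    (hsmul : ∀ (t : ℝ) (v : X), v ∈ C → t • v ∈ C) {w : X} (hw : w ∉ C) :
    (0 : X) ∉ interior C := by
  intro h
  have h1 : Tendsto (fun s : ℝ => s • w) (𝓝[>] 0) (𝓝 0) := by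
    have : Tendsto (fun s : ℝ => s • w) (𝓝 0) (𝓝 ((0:ℝ) • w)) :=
      (continuous_id.smul continuous_const).tendsto 0
    rw [zero_smul] at this
    exact this.mono_left nhdsWithin_le_nhds
  obtain ⟨s, hs, hs0⟩ := ((h1.eventually (mem_interior_iff_mem_nhds.1 h)).and
    self_mem_nhdsWithin).exists
  have hs0 : (0:ℝ) < s := hs0
  have := hsmul s⁻¹ _ hs
  rw [inv_smul_smul₀ hs0.ne'] at this
  exact hw this

theorem StronglyFocusing.le_norm_sub {C : Set X}
    (hsmul : ∀ (t : ℝ) (v : X), v ∈ C → t • v ∈ C) {R : X →L[ℝ] X} {κ : ℝ}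
    (hR : StronglyFocusing R C κ) {v u : X} (hv : v ∈ C) (hu : u ∉ C) :
    κ * ‖R v‖ ≤ ‖R v - u‖ := by
  by_cases h0 : R v = 0
  · simp [h0]
  have hpos : 0 < ‖R v‖ := norm_pos_iff.2 h0
  have h := hR.2 (R (‖R v‖⁻¹ • v)) ⟨_, hsmul _ _ hv, rfl⟩
    (by rw [map_smul, norm_smul, norm_inv, norm_norm, inv_mul_cancel₀ hpos.ne'])
    (‖R v‖⁻¹ • u) (fun h => hu (by
      have := hsmul ‖R v‖ _ h
      rwa [smul_inv_smul₀ hpos.ne'] at this))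
  rw [map_smul, ← smul_sub, norm_smul, norm_inv, norm_norm, inv_mul_eq_div,
    le_div_iff₀ hpos] at h
  exact h

/-- The derivative of a map inherits the focusing property of its difference operators. -/
theorem HasFDerivAt.le_norm_sub_of_stronglyFocusing {C : Set X}
    (hsmul : ∀ (t : ℝ) (v : X), v ∈ C → t • v ∈ C) {g : X → X} {A : X →L[ℝ] X} {p : X}
    (hg : HasFDerivAt g A p) {κ : ℝ}
    (hfoc : ∀ᶠ x in 𝓝 p, ∃ R : X →L[ℝ] X, StronglyFocusing R C κ ∧ R (x - p) = g x - g p)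
    {v u : X} (hv : v ∈ C) (hu : u ∉ C) : κ * ‖A v‖ ≤ ‖A v - u‖ := by
  have hlim : Tendsto (fun s : ℝ => s⁻¹ • (g (p + s • v) - g p)) (𝓝[≠] 0) (𝓝 (A v)) :=
    (hasDerivAt_iff_tendsto_slope_zero.1
      (show HasDerivAt (fun s : ℝ => g (p + s • v)) (A v) 0 from hg.hasLineDerivAt v)).congr
      fun s => by simp
  have hp : Tendsto (fun s : ℝ => p + s • v) (𝓝[≠] 0) (𝓝 p) := by
    have : Tendsto (fun s : ℝ => p + s • v) (𝓝 0) (𝓝 (p + (0:ℝ) • v)) :=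
      Continuous.tendsto (by fun_prop) 0
    rw [zero_smul, add_zero] at this
    exact this.mono_left nhdsWithin_le_nhds
  refine le_of_tendsto_of_tendsto (hlim.norm.const_mul κ) (hlim.sub_const u).norm ?_
  filter_upwards [hp.eventually hfoc, self_mem_nhdsWithin] with s ⟨R, hR, hRe⟩ hs
  have hs : s ≠ 0 := hs
  have e : s⁻¹ • (g (p + s • v) - g p) = R v := by
    rw [← hRe, add_sub_cancel_left, map_smul, inv_smul_smul₀ hs]
  rw [e]
  exact hR.le_norm_sub hsmul hv hu

/-- A compact derivative at a fixed point that is a limit of fixed points `q` with `q - p ∉ C`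
has a unit fixed vector outside `interior C`. -/
theorem exists_fixed_unit_vector {C : Set X}
    (hsmul : ∀ (t : ℝ) (v : X), v ∈ C → t • v ∈ C) {g : X → X} {A : X →L[ℝ] X} {p : X}
    (hg : HasFDerivAt g A p) (hA : IsCompactOperator ⇑A) (hp : g p = p)
    (hq : ∃ᶠ q in 𝓝[≠] p, g q = q ∧ q - p ∉ C) :
    ∃ w : X, w ∉ interior C ∧ ‖w‖ = 1 ∧ A w = w := by
  obtain ⟨q, hqlim, hqP⟩ := exists_seq_forall_of_frequently hq
  have hne : ∀ᶠ n in atTop, q n ≠ p := hqlim.eventually self_mem_nhdsWithin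
  have hqlim' : Tendsto q atTop (𝓝 p) := hqlim.mono_right nhdsWithin_le_nhds
  set w : ℕ → X := fun n => ‖q n - p‖⁻¹ • (q n - p) with hwdef
  have hw1 : ∀ᶠ n in atTop, ‖w n‖ = 1 := by
    filter_upwards [hne] with n hn
    have : ‖q n - p‖ ≠ 0 := norm_ne_zero_iff.2 (sub_ne_zero.2 hn)
    simp [hwdef, norm_smul, this]
  have hwle : ∀ n, ‖w n‖ ≤ 1 := fun n => by
    simp only [hwdef, norm_smul, norm_inv, norm_norm]
    exact inv_mul_le_one
  have hdiff : Tendsto (fun n => w n - A (w n)) atTop (𝓝 0) := by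
    rw [tendsto_zero_iff_norm_tendsto_zero]
    have := (hasFDerivAt_iff_tendsto.1 hg).comp hqlim'
    refine this.congr fun n => ?_
    simp only [Function.comp, (hqP n).1, hp, hwdef, map_smul, ← smul_sub, norm_smul, norm_inv,
      norm_norm]
  obtain ⟨K, hK, hKsub⟩ := hA.image_subset_compact_of_bounded
    (show Bornology.IsBounded (closedBall (0:X) 1) from isBounded_closedBall)
  obtain ⟨z, -, φ, hφ, hz⟩ := hK.tendsto_subseq (x := fun n => A (w n))
    (fun n => hKsub ⟨w n, by simpa using hwle n, rfl⟩)
  have hwz : Tendsto (fun n => w (φ n)) atTop (𝓝 z) := by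
    have := (hdiff.comp hφ.tendsto_atTop).add hz
    simpa [Function.comp_def] using this
  refine ⟨z, ?_, ?_, ?_⟩
  · have hev : ∀ᶠ n in atTop, w (φ n) ∈ (interior C)ᶜ := by
      filter_upwards [hφ.tendsto_atTop.eventually hne] with n hn hmem
      have h0 : ‖q (φ n) - p‖ ≠ 0 := norm_ne_zero_iff.2 (sub_ne_zero.2 hn)
      have := hsmul ‖q (φ n) - p‖ _ (interior_subset hmem)
      rw [hwdef, smul_inv_smul₀ h0] at this
      exact (hqP _).2 this
    exact isOpen_interior.isClosed_compl.mem_of_tendsto hwz hev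
  · exact tendsto_nhds_unique hwz.norm
      (tendsto_const_nhds.congr' ((hφ.tendsto_atTop.eventually hw1).mono fun n hn => hn.symm))
  · exact tendsto_nhds_unique ((A.continuous.tendsto z).comp hwz) hz

end ConeGrowth

section OmegaLimit

variable {X : Type*} [NormedAddCommGroup X] [NormedSpace ℝ X]

theorem Semiflow.continuous_toFun (Φ : Semiflow X) {t : ℝ} (ht : 0 ≤ t) :
    Continuous (Φ.toFun t) :=
  Φ.cont.comp_continuous (f := fun y => (t, y)) (by fun_prop) fun _ => ⟨ht, mem_univ _⟩

theorem Semiflow.continuousOn_orbit (Φ : Semiflow X) (x : X) :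
    ContinuousOn (fun t => Φ.toFun t x) (Ici 0) :=
  Φ.cont.comp (f := fun t => (t, x)) (by fun_prop) fun _ ht => ⟨ht, mem_univ _⟩

theorem Semiflow.toFun_nat_mul (Φ : Semiflow X) {T : ℝ} (hT : 0 ≤ T) (n : ℕ) (y : X) :
    Φ.toFun (n * T) y = (Φ.toFun T)^[n] y := by
  induction n with
  | zero => simp [Φ.map_zero]
  | succ n ih =>
    rw [Function.iterate_succ_apply', ← ih, ← Φ.map_add _ _ hT (by positivity)]
    congr 1
    push_cast
    ring

theorem mem_omegaSet_iff_mapClusterPt {Φ : Semiflow X} {x p : X} :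
    p ∈ omegaSet Φ x ↔ MapClusterPt p atTop (fun t => Φ.toFun t x) := by
  rw [mapClusterPt_iff_frequently]
  simp only [omegaSet, mem_iInter, mem_closure_iff_nhds]
  constructor
  · intro h s hs
    rw [frequently_atTop]
    intro a
    obtain ⟨_, hy, t, ht, rfl⟩ := h (max a 0) (mem_Ici.2 (le_max_right _ _)) s hs
    exact ⟨t, (le_max_left _ _).trans ht, hy⟩
  · intro h s _ U hU
    obtain ⟨t, ht, hy⟩ := (frequently_atTop.1 (h U hU)) s
    exact ⟨_, hy, t, ht, rfl⟩

theorem exists_mem_omegaSet_mapClusterPt {Φ : Semiflow X} {x : X}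
    (hpre : IsCompact (closure (posOrbit Φ x))) {l : Filter ℝ} [l.NeBot] (hl : l ≤ atTop) :
    ∃ p ∈ omegaSet Φ x, MapClusterPt p l (fun t => Φ.toFun t x) := by
  obtain ⟨p, -, hp⟩ := hpre.exists_mapClusterPt (f := l) (u := fun t => Φ.toFun t x) (by
    rw [le_principal_iff, mem_map]
    filter_upwards [hl (Ici_mem_atTop 0)] with t ht
    exact subset_closure ⟨t, ht, rfl⟩)
  exact ⟨p, mem_omegaSet_iff_mapClusterPt.2 (hp.mono hl), hp⟩

theorem isCompact_omegaSet {Φ : Semiflow X} {x : X}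
    (hpre : IsCompact (closure (posOrbit Φ x))) : IsCompact (omegaSet Φ x) :=
  hpre.of_isClosed_subset (isClosed_biInter fun _ _ => isClosed_closure)
    (biInter_subset_of_mem (mem_Ici.2 (le_refl (0:ℝ))))

/-- Between two points of an ω-limit set there are points of the set at every intermediate
distance from the first. -/
theorem exists_mem_omegaSet_norm_sub_eq {Φ : Semiflow X} {x : X}
    (hpre : IsCompact (closure (posOrbit Φ x))) {p q : X} (hp : p ∈ omegaSet Φ x)
    (hq : q ∈ omegaSet Φ x) {ε : ℝ} (hε : 0 < ε) (hεq : ε < ‖q - p‖) :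
    ∃ z ∈ omegaSet Φ x, ‖z - p‖ = ε := by
  rw [mem_omegaSet_iff_mapClusterPt, mapClusterPt_iff_frequently] at hp hq
  have hcont : Continuous fun y : X => ‖y - p‖ := by fun_prop
  have h1 := hp {y | ‖y - p‖ < ε} ((isOpen_lt hcont continuous_const).mem_nhds (by simpa))
  have h2 := hq {y | ε < ‖y - p‖} ((isOpen_lt continuous_const hcont).mem_nhds hεq)
  have h3 : ∃ᶠ t in atTop, ‖Φ.toFun t x - p‖ = ε := by
    rw [frequently_atTop] at h1 h2 ⊢
    intro a
    obtain ⟨s, hs, hs'⟩ := h1 (max a 0)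
    obtain ⟨t, ht, ht'⟩ := h2 s
    have hs0 : 0 ≤ s := (le_max_right _ _).trans hs
    obtain ⟨r, hr, hr'⟩ := intermediate_value_Icc (f := fun t => ‖Φ.toFun t x - p‖) ht
      (hcont.comp_continuousOn ((Φ.continuousOn_orbit x).mono fun r hr => hs0.trans hr.1))
      ⟨le_of_lt hs', le_of_lt ht'⟩
    exact ⟨r, (le_max_left _ _).trans (hs.trans hr.1), hr'⟩
  have : NeBot (atTop ⊓ 𝓟 {t : ℝ | ‖Φ.toFun t x - p‖ = ε}) := frequently_mem_iff_neBot.1 h3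
  obtain ⟨z, hz, hzc⟩ := exists_mem_omegaSet_mapClusterPt hpre
    (inf_le_left : atTop ⊓ 𝓟 {t : ℝ | ‖Φ.toFun t x - p‖ = ε} ≤ atTop)
  refine ⟨z, hz, ?_⟩
  have hcl := (isClosed_eq hcont (continuous_const (y := ε)))
  refine hcl.mem_of_mapClusterPt hzc ?_
  exact mem_inf_of_right (mem_principal_self _)

/-- If the ω-limit set consists of equilibria, then orbit points issued from two shifts of the
orbit get close to each other. -/
theorem tendsto_toFun_sub_toFun {Φ : Semiflow X} {x : X}
    (hpre : IsCompact (closure (posOrbit Φ x))) (hE : omegaSet Φ x ⊆ equilibria Φ)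
    {t₁ t₂ : ℝ} (h₁ : 0 ≤ t₁) (h₂ : 0 ≤ t₂) :
    Tendsto (fun t => ‖Φ.toFun t (Φ.toFun t₁ x) - Φ.toFun t (Φ.toFun t₂ x)‖) atTop (𝓝 0) := by
  have hc : Continuous fun y => ‖Φ.toFun t₁ y - Φ.toFun t₂ y‖ :=
    ((Φ.continuous_toFun h₁).sub (Φ.continuous_toFun h₂)).norm
  have hEq : (fun t => ‖Φ.toFun t₁ (Φ.toFun t x) - Φ.toFun t₂ (Φ.toFun t x)‖) =ᶠ[atTop]
      fun t => ‖Φ.toFun t (Φ.toFun t₁ x) - Φ.toFun t (Φ.toFun t₂ x)‖ := by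
    filter_upwards [eventually_ge_atTop 0] with t ht
    rw [← Φ.map_add _ _ h₁ ht, ← Φ.map_add _ _ h₂ ht, ← Φ.map_add _ _ ht h₁,
      ← Φ.map_add _ _ ht h₂, add_comm t₁, add_comm t₂]
  refine Tendsto.congr' hEq ?_
  by_contra hn
  rw [Metric.tendsto_nhds] at hn
  push Not at hn
  obtain ⟨ε, hε, hf⟩ := hn
  have : NeBot (atTop ⊓ 𝓟 {t : ℝ | ¬ dist ‖Φ.toFun t₁ (Φ.toFun t x) - Φ.toFun t₂ (Φ.toFun t x)‖ 0
    < ε}) := frequently_mem_iff_neBot.1 (by simpa using hf)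
  obtain ⟨z, hz, hzc⟩ := exists_mem_omegaSet_mapClusterPt hpre
    (inf_le_left : atTop ⊓ 𝓟 {t : ℝ | ¬ dist ‖Φ.toFun t₁ (Φ.toFun t x) -
      Φ.toFun t₂ (Φ.toFun t x)‖ 0 < ε} ≤ atTop)
  have h0 : z ∈ {y | ¬ dist ‖Φ.toFun t₁ y - Φ.toFun t₂ y‖ 0 < ε} :=
    (isOpen_lt (hc.dist continuous_const) continuous_const).isClosed_compl.mem_of_mapClusterPt hzc
      (mem_inf_of_right (mem_principal_self _))
  apply h0
  rw [hE hz t₁ h₁, hE hz t₂ h₂]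
  simpa using hε

end OmegaLimit

/-- A positive continuous function on `[0, ∞)` vanishing at infinity has arbitrarily late times
from which on it never exceeds its present value. -/
theorem frequently_forall_ge_le_of_tendsto_zero {f : ℝ → ℝ} (hf : ContinuousOn f (Ici 0))
    (hpos : ∀ t, 0 ≤ t → 0 < f t) (hlim : Tendsto f atTop (𝓝 0)) :
    ∃ᶠ t in atTop, ∀ s, t ≤ s → f s ≤ f t := by
  rw [frequently_atTop]
  intro a
  set b := max a 0
  have hb : 0 ≤ b := le_max_right _ _
  obtain ⟨M, hM⟩ := eventually_atTop.1 (hlim.eventually_lt_const (hpos b hb))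
  obtain ⟨t, ht, hmax⟩ := (isCompact_Icc (a := b) (b := max b M)).exists_isMaxOn
    ⟨b, le_rfl, le_max_left _ _⟩ (hf.mono fun r hr => hb.trans hr.1)
  refine ⟨t, (le_max_left _ _).trans ht.1, fun s hs => ?_⟩
  rcases le_total s (max b M) with h | h
  · exact hmax ⟨ht.1.trans hs, h⟩
  · exact (hM s ((le_max_right _ _).trans h)).le.trans (hmax ⟨le_rfl, le_max_left _ _⟩)

/-- **Alternative (b) does not occur (Lemma 4.1).** For a semiflow strongly focusing
monotone w.r.t. the `k`-cone `C` satisfying the standing assumptions and a precompact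
pseudo-ordered semiorbit `O⁺(x)`, `ω(x)` is not an unordered set consisting of
equilibria. -/
theorem alternative_b_excluded
    {X : Type*} [NormedAddCommGroup X] [NormedSpace ℝ X] [CompleteSpace X]
    (Φ : Semiflow X) (DΦ : ℝ → X → X →L[ℝ] X) (C : Set X) (k : ℕ) (hk : 1 ≤ k)
    (hSA : StandingAssumptions Φ DΦ C k)
    (hSFM : StronglyFocusingMonotone Φ DΦ C)
    (x : X) (hpre : IsCompact (closure (posOrbit Φ x)))
    (hpo : PseudoOrdered Φ C x) :
    ¬ (omegaSet Φ x ⊆ equilibria Φ ∧ UnorderedSet C (omegaSet Φ x)) := by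
  rintro ⟨hE, hns, hun⟩
  obtain ⟨⟨hCc, hsmul, -, -⟩, -, -, hcomp, -⟩ := hSA
  obtain ⟨hder, hdercont, ⟨hmono, hsmono⟩, hDint, hfocus⟩ := hSFM
  obtain ⟨t₁, t₂, h₁, h₂, hne, hord⟩ := hpo
  obtain ⟨δ, hδ, T, hT, κ, hκ, hR⟩ := hfocus _ (isCompact_omegaSet hpre) (fun t ht => by
    refine Subset.antisymm ?_ fun z hz => ⟨z, hz, hE hz t ht⟩
    rintro _ ⟨z, hz, rfl⟩
    rwa [hE hz t ht])
  have hother : ∀ p ∈ omegaSet Φ x, ∃ q ∈ omegaSet Φ x, q ≠ p := by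
    intro p hp
    by_contra! h
    exact hns ⟨p, Subset.antisymm h (singleton_subset_iff.2 hp)⟩
  -- the origin is not interior to the cone, so distinct ordered points stay distinct
  have h0 : (0 : X) ∉ interior C := by
    obtain ⟨p, hp, -⟩ := exists_mem_omegaSet_mapClusterPt hpre (le_refl atTop)
    obtain ⟨q, hq, hqp⟩ := hother p hp
    exact zero_notMem_interior_of_smul_mem hsmul (hun q hq p hp hqp)
  set a := Φ.toFun t₁ x with ha
  set b := Φ.toFun t₂ x with hb
  have hdpos : ∀ t, 0 ≤ t → 0 < ‖Φ.toFun t a - Φ.toFun t b‖ := by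
    intro t ht
    rw [norm_pos_iff]
    intro h
    rcases ht.eq_or_lt with rfl | ht
    · rw [Φ.map_zero, Φ.map_zero] at h
      exact hne (sub_eq_zero.1 h)
    · exact h0 (h ▸ hsmono t ht a b hord hne)
  have hrec := frequently_forall_ge_le_of_tendsto_zero
    (((Φ.continuousOn_orbit a).sub (Φ.continuousOn_orbit b)).norm) hdpos
    (tendsto_toFun_sub_toFun hpre hE h₁ h₂)
  set f : ℝ → ℝ := fun t => ‖Φ.toFun t a - Φ.toFun t b‖ with hf
  -- a cluster point of the orbit, time `T` before the record times of `f`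
  have hfreq : ∃ᶠ t in atTop, ∀ s, t + T ≤ s → f s ≤ f (t + T) := by
    rw [frequently_atTop] at hrec ⊢
    intro c
    obtain ⟨t, ht, h⟩ := hrec (c + T)
    exact ⟨t - T, by linarith, by simpa using h⟩
  have hbot : NeBot (atTop ⊓ 𝓟 {t : ℝ | ∀ s, t + T ≤ s → f s ≤ f (t + T)}) :=
    frequently_mem_iff_neBot.1 hfreq
  obtain ⟨p, hp, hpc⟩ := exists_mem_omegaSet_mapClusterPt hpre
    (inf_le_left : atTop ⊓ 𝓟 {t : ℝ | ∀ s, t + T ≤ s → f s ≤ f (t + T)} ≤ atTop)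
  have hgp : Φ.toFun T p = p := hE hp T hT.le
  set A := DΦ T p with hAdef
  have hgA : HasStrictFDerivAt (Φ.toFun T) A p :=
    hasStrictFDerivAt_of_hasFDerivAt_of_continuousAt
      (Eventually.of_forall fun y => hder T hT.le y) (hdercont T hT.le).continuousAt
  have hAinv : ∀ v ∈ C, A v ∈ C := fun v hv => by
    by_cases hv0 : v = 0
    · subst hv0; simpa using hv
    · exact interior_subset (hDint T hT p v hv hv0)
  obtain ⟨w, hwint, hw1, hAw⟩ := exists_fixed_unit_vector hsmul hgA.hasFDerivAt (hcomp T hT p) hgp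
    (by
      obtain ⟨q, hq, hqp⟩ := hother p hp
      rw [frequently_iff]
      intro U hU
      obtain ⟨ε, hε, hεU⟩ := Metric.mem_nhdsWithin_iff.1 hU
      have hqpos : 0 < ‖q - p‖ := norm_pos_iff.2 (sub_ne_zero.2 hqp)
      have hmin : 0 < min ε ‖q - p‖ := lt_min hε hqpos
      obtain ⟨z, hz, hzε⟩ := exists_mem_omegaSet_norm_sub_eq hpre hp hq (half_pos hmin)
        (by linarith [min_le_right ε ‖q - p‖])
      have hzp : z ≠ p := by
        rintro rfl
        simp only [sub_self, norm_zero] at hzε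
        linarith
      exact ⟨z, hεU ⟨by rw [mem_ball_iff_norm]; linarith [min_le_left ε ‖q - p‖], hzp⟩,
        hE hz T hT.le, hun z hz p hp hzp⟩)
  have hwC : w ∉ C := fun hw => hwint <| by
    have := hDint T hT p w hw (by rintro rfl; simp at hw1)
    rwa [← hAdef, hAw] at this
  have hAfoc : ∀ v ∈ C, ∀ u ∉ C, κ * ‖A v‖ ≤ ‖A v - u‖ := fun v hv u hu =>
    hgA.hasFDerivAt.le_norm_sub_of_stronglyFocusing hsmul (by
      filter_upwards [closedBall_mem_nhds p hδ] with y hy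
      exact hR p hp y hy p (mem_closedBall_self hδ.le)) hv hu
  obtain ⟨c, hc, l, hl, hgrow⟩ :=
    exists_exp_growth_of_focusing hCc hsmul A hκ hAfoc hAinv hwC hw1 hAw
  obtain ⟨n, hn⟩ := pow_unbounded_of_one_lt (3 / c) hl
  have hn3 : 3 ≤ c * l ^ n := by rw [div_lt_iff₀ hc] at hn; linarith
  have hstrict := (hgA.iterate hgp n).isLittleO.bound one_pos
  -- evaluate all local estimates at the two shifted orbits
  have hshift : ∀ r, 0 ≤ r → Tendsto (Φ.toFun r) (𝓝 p) (𝓝 p) := fun r hr => by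
    have := (Φ.continuous_toFun hr).tendsto p
    rwa [hE hp r hr] at this
  have hloc : ∀ᶠ y in 𝓝 p, Φ.toFun t₁ y ∈ closedBall p δ ∧ Φ.toFun t₂ y ∈ closedBall p δ ∧
      ‖(Φ.toFun T)^[n] (Φ.toFun (T + t₁) y) - (Φ.toFun T)^[n] (Φ.toFun (T + t₂) y) -
        (A ^ n) (Φ.toFun (T + t₁) y - Φ.toFun (T + t₂) y)‖ ≤
        1 * ‖Φ.toFun (T + t₁) y - Φ.toFun (T + t₂) y‖ :=
    ((hshift _ h₁).eventually (closedBall_mem_nhds p hδ)).and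
      (((hshift _ h₂).eventually (closedBall_mem_nhds p hδ)).and
        (((hshift _ (by positivity : 0 ≤ T + t₁)).prodMk_nhds
          (hshift _ (by positivity : 0 ≤ T + t₂))).eventually hstrict))
  have hev : ∀ᶠ t in atTop ⊓ 𝓟 {t : ℝ | ∀ s, t + T ≤ s → f s ≤ f (t + T)},
      (∀ s, t + T ≤ s → f s ≤ f (t + T)) ∧ 0 ≤ t :=
    Eventually.and (mem_inf_of_right (mem_principal_self _))
      (mem_inf_of_left (eventually_ge_atTop 0))
  obtain ⟨t, ⟨hy₁, hy₂, hy⟩, hrect, ht⟩ :=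
    ((mapClusterPt_iff_frequently.1 hpc _ hloc).and_eventually hev).exists
  have e₁ : Φ.toFun t₁ (Φ.toFun t x) = Φ.toFun t a := by
    rw [ha, ← Φ.map_add _ _ h₁ ht, ← Φ.map_add _ _ ht h₁, add_comm]
  have e₂ : Φ.toFun t₂ (Φ.toFun t x) = Φ.toFun t b := by
    rw [hb, ← Φ.map_add _ _ h₂ ht, ← Φ.map_add _ _ ht h₂, add_comm]
  rw [Φ.map_add _ _ hT.le h₁, Φ.map_add _ _ hT.le h₂, e₁, e₂] at hy
  clear_value a b
  rw [e₁] at hy₁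
  rw [e₂] at hy₂
  obtain ⟨R, hRfoc, hRe⟩ := hR p hp _ hy₁ _ hy₂
  have hordt := hmono t ht a b hord
  have hvC := hmono T hT.le _ _ hordt
  have hexp := hgrow n _ hvC fun u hu => by
    rw [← hRe]
    exact hRfoc.le_norm_sub hsmul hordt hu
  rw [← Φ.toFun_nat_mul hT.le, ← Φ.toFun_nat_mul hT.le, ← Φ.map_add _ _ hT.le ht,
    ← Φ.map_add _ _ hT.le ht, ← Φ.map_add _ _ (by positivity) (by positivity),
    ← Φ.map_add _ _ (by positivity) (by positivity), add_comm T t] at hy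
  rw [← Φ.map_add _ _ hT.le ht, ← Φ.map_add _ _ hT.le ht, add_comm T t] at hexp
  have hr : f (n * T + (t + T)) ≤ f (t + T) := hrect _ (by
    have : 0 ≤ n * T := by positivity
    linarith)
  have hpos : 0 < f (t + T) := hdpos _ (by positivity)
  have htri := norm_sub_norm_le
    ((A ^ n) (Φ.toFun (t + T) a - Φ.toFun (t + T) b))
    (Φ.toFun (n * T + (t + T)) a - Φ.toFun (n * T + (t + T)) b)
  rw [norm_sub_rev ((A ^ n) _)] at htri
  simp only [hf] at hr hpos
  nlinarith [mul_le_mul_of_nonneg_right hn3 hpos.le]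
end
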